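/- Let N ≥ 2, 0 ≤ m ≤ N−2, and assume t ≠ 0 and [n]_t ≠ 0 for 1 ≤ n ≤ m+1. For N−m−1 ≤ i ≤ N set π_i := φ_{{N−m−1,…,N}∖{i}} ∈ P. Then (T_{N−1} − t)(T_{N−2} − κ_2)(T_{N−3} − κ_3)⋯(T_{N−m−1} − κ_{m+1}) π_{N−m−1} = Σ_{i=0}^{m+1} (−1)^{m+1−i} t^{i} π_{N−m−1+i} = (−1)^{m+1} t^{m+2−N} · D(φ_{{N−m−1,…,N}}), where the operator product is composed so that the rightmost factor (T_{N−m−1} − κ_{m+1}) acts first. In particular this operator annihilates D(π_{N−m−1}). -/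

import Mathlib

open Finset

noncomputable def phi (K : Type*) [Field K] (E : Finset ℕ) : Finset ℕ →₀ K :=
  Finsupp.single E 1

noncomputable def Tgen {K : Type*} [Field K] (t : K) (i : ℕ) :
    (Finset ℕ →₀ K) →ₗ[K] (Finset ℕ →₀ K) :=
  Finsupp.lift _ K _ fun E =>
    if i ∈ E then
      if i + 1 ∈ E then -(phi K E)
      else phi K (insert (i + 1) (E.erase i))
    else
      if i + 1 ∈ E then t • phi K (insert i (E.erase (i + 1))) + (t - 1) • phi K E
      else t • phi K E

def sgn (i : ℕ) (E : Finset ℕ) : ℕ := (E.filter (· < i)).card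

noncomputable def Mop (K : Type*) [Field K] (N : ℕ) :
    (Finset ℕ →₀ K) →ₗ[K] (Finset ℕ →₀ K) :=
  Finsupp.lift _ K _ fun E =>
    ∑ i ∈ (Finset.Icc 1 N) \ E, ((-1 : K) ^ sgn i E) • phi K (insert i E)

noncomputable def Dop {K : Type*} [Field K] (t : K) :
    (Finset ℕ →₀ K) →ₗ[K] (Finset ℕ →₀ K) :=
  Finsupp.lift _ K _ fun E =>
    ∑ i ∈ E, ((-1 : K) ^ sgn i E * t ^ (i - 1)) • phi K (E.erase i)

noncomputable def qint {K : Type*} [Field K] (t : K) (n : ℕ) : K :=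
  ∑ i ∈ Finset.range n, t ^ i

noncomputable def kappa {K : Type*} [Field K] (t : K) (n : ℤ) : K :=
  if 0 < n then t ^ n.toNat / qint t n.toNat else -(1 / qint t (-n).toNat)

section Operators

variable {K : Type*} [Field K] (t : K)

theorem lift_phi {M : Type*} [AddCommGroup M] [Module K M] (f : Finset ℕ → M) (E : Finset ℕ) :
    Finsupp.lift M K (Finset ℕ) f (phi K E) = f E := by
  simp [phi]

theorem Tgen_phi (i : ℕ) (E : Finset ℕ) :
    Tgen t i (phi K E) =
      if i ∈ E then
        if i + 1 ∈ E then -(phi K E)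
        else phi K (insert (i + 1) (E.erase i))
      else
        if i + 1 ∈ E then t • phi K (insert i (E.erase (i + 1))) + (t - 1) • phi K E
        else t • phi K E := by
  exact lift_phi _ E

theorem Dop_phi (E : Finset ℕ) :
    Dop t (phi K E) =
      ∑ i ∈ E, ((-1 : K) ^ sgn i E * t ^ (i - 1)) • phi K (E.erase i) := by
  exact lift_phi _ E

theorem hom_ext_phi {M : Type*} [AddCommGroup M] [Module K M]
    {f g : (Finset ℕ →₀ K) →ₗ[K] M} (h : ∀ E, f (phi K E) = g (phi K E)) : f = g :=
  Finsupp.lhom_ext' fun E => LinearMap.ext_ring (h E)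

theorem sgn_insert_of_lt {x j : ℕ} {E : Finset ℕ} (hx : x ∉ E) (h : x < j) :
    sgn j (insert x E) = sgn j E + 1 := by
  rw [sgn, filter_insert, if_pos h, card_insert_of_notMem (by simp [hx]), sgn]

theorem sgn_insert_of_le {x j : ℕ} {E : Finset ℕ} (h : j ≤ x) :
    sgn j (insert x E) = sgn j E := by
  rw [sgn, filter_insert, if_neg (by omega), sgn]

theorem sgn_succ {i : ℕ} {E : Finset ℕ} (h : i ∉ E) : sgn (i + 1) E = sgn i E := by
  unfold sgn
  congr 1
  ext x
  simp only [mem_filter]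
  grind

theorem Dop_phi_insert {i : ℕ} {F : Finset ℕ} (hi : i ∉ F) :
    Dop t (phi K (insert i F)) = ((-1 : K) ^ sgn i F * t ^ (i - 1)) • phi K F +
      ∑ j ∈ F, ((-1 : K) ^ sgn j (insert i F) * t ^ (j - 1)) •
        phi K (insert i (F.erase j)) := by
  rw [Dop_phi, sum_insert hi, erase_insert hi, sgn_insert_of_le le_rfl]
  congr 1
  refine sum_congr rfl fun j hj => ?_
  rw [erase_insert_of_ne (by grind)]

theorem Tgen_phi_of_notMem {i : ℕ} {F : Finset ℕ} (h0 : i ∉ F) (h1 : i + 1 ∉ F) :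
    Tgen t i (phi K F) = t • phi K F := by
  rw [Tgen_phi, if_neg h0, if_neg h1]

theorem Tgen_phi_insert {i : ℕ} {F : Finset ℕ} (h0 : i ∉ F) (h1 : i + 1 ∉ F) :
    Tgen t i (phi K (insert i F)) = phi K (insert (i + 1) F) := by
  rw [Tgen_phi, if_pos (by simp), if_neg (by simp [h1]), erase_insert h0]

theorem Tgen_phi_insert_succ {i : ℕ} {F : Finset ℕ} (h0 : i ∉ F) (h1 : i + 1 ∉ F) :
    Tgen t i (phi K (insert (i + 1) F)) =
      t • phi K (insert i F) + (t - 1) • phi K (insert (i + 1) F) := by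
  rw [Tgen_phi, if_neg (by simp [h0]), if_pos (by simp), erase_insert h1]

theorem Tgen_phi_of_mem {i : ℕ} {E : Finset ℕ} (h0 : i ∈ E) (h1 : i + 1 ∈ E) :
    Tgen t i (phi K E) = -phi K E := by
  rw [Tgen_phi, if_pos h0, if_pos h1]

theorem sgn_insert_succ {i j : ℕ} {F : Finset ℕ} (h0 : i ∉ F) (h1 : i + 1 ∉ F) (hj : j ∈ F) :
    sgn j (insert (i + 1) F) = sgn j (insert i F) := by
  have h2 : j ≠ i := by grind
  have h3 : j ≠ i + 1 := by grind
  rcases lt_or_ge i j with h | h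
  · rw [sgn_insert_of_lt h1 (by omega), sgn_insert_of_lt h0 h]
  · rw [sgn_insert_of_le (by omega), sgn_insert_of_le h]

theorem Tgen_commute_Dop {i : ℕ} (hi : 1 ≤ i) :
    Commute (Tgen t i : Module.End K (Finset ℕ →₀ K)) (Dop t) := by
  refine hom_ext_phi fun E => ?_
  rw [Module.End.mul_apply, Module.End.mul_apply]
  obtain ⟨F, h0, h1, hE⟩ : ∃ F : Finset ℕ, i ∉ F ∧ i + 1 ∉ F ∧
      (E = F ∨ E = insert i F ∨ E = insert (i + 1) F ∨ E = insert i (insert (i + 1) F)) := by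
    refine ⟨(E.erase i).erase (i + 1), by simp, by simp, ?_⟩
    by_cases h : i ∈ E <;> by_cases h' : i + 1 ∈ E
    · right; right; right; ext x; grind
    · right; left; ext x; grind
    · right; right; left; ext x; grind
    · left; ext x; grind
  have e0 : ∀ j, i ∉ F.erase j := fun j h => h0 (mem_of_mem_erase h)
  have e1 : ∀ j, i + 1 ∉ F.erase j := fun j h => h1 (mem_of_mem_erase h)
  have hpow : t ^ (i + 1 - 1) = t * t ^ (i - 1) := by
    rw [← pow_succ']; congr 1; omega
  have hD1 : Dop t (phi K (insert (i + 1) F)) =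
      ((-1 : K) ^ sgn i F * (t * t ^ (i - 1))) • phi K F +
      ∑ j ∈ F, ((-1 : K) ^ sgn j (insert i F) * t ^ (j - 1)) •
        phi K (insert (i + 1) (F.erase j)) := by
    rw [Dop_phi_insert t h1, hpow, sgn_succ h0]
    congr 1
    exact sum_congr rfl fun j hj => by rw [sgn_insert_succ h0 h1 hj]
  rcases hE with rfl | rfl | rfl | rfl
  · rw [Tgen_phi_of_notMem t h0 h1, map_smul, Dop_phi, map_sum, smul_sum]
    refine sum_congr rfl fun j _ => ?_
    rw [map_smul, Tgen_phi_of_notMem t (e0 j) (e1 j), smul_comm]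
  · rw [Tgen_phi_insert t h0 h1, hD1, Dop_phi_insert t h0, map_add, map_smul, map_sum,
      Tgen_phi_of_notMem t h0 h1, smul_smul]
    congr 1
    · congr 1; ring
    · refine sum_congr rfl fun j _ => ?_
      rw [map_smul, Tgen_phi_insert t (e0 j) (e1 j)]
  · rw [Tgen_phi_insert_succ t h0 h1, map_add, map_smul, map_smul, hD1, Dop_phi_insert t h0,
      map_add, map_smul, map_sum, Tgen_phi_of_notMem t h0 h1]
    have hsum : ∑ j ∈ F, Tgen t i (((-1 : K) ^ sgn j (insert i F) * t ^ (j - 1)) •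
          phi K (insert (i + 1) (F.erase j))) =
        t • ∑ j ∈ F, ((-1 : K) ^ sgn j (insert i F) * t ^ (j - 1)) •
          phi K (insert i (F.erase j)) +
        (t - 1) • ∑ j ∈ F, ((-1 : K) ^ sgn j (insert i F) * t ^ (j - 1)) •
          phi K (insert (i + 1) (F.erase j)) := by
      rw [smul_sum, smul_sum, ← sum_add_distrib]
      refine sum_congr rfl fun j _ => ?_
      rw [map_smul, Tgen_phi_insert_succ t (e0 j) (e1 j)]
      module
    rw [hsum]
    module
  · have h0' : i ∉ insert (i + 1) F := by simp [h0]
    rw [Tgen_phi_of_mem t (by simp) (by simp), map_neg, Dop_phi_insert t h0',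
      sum_insert h1, erase_insert h1, sgn_insert_of_le (Nat.le_succ i),
      sgn_insert_of_lt h0' (Nat.lt_succ_self i), sgn_insert_of_le le_rfl, sgn_succ h0, hpow,
      map_add, map_add, map_smul, map_smul, Tgen_phi_insert_succ t h0 h1,
      Tgen_phi_insert t h0 h1, map_sum]
    have hsum : ∑ j ∈ F, Tgen t i
          (((-1 : K) ^ sgn j (insert i (insert (i + 1) F)) * t ^ (j - 1)) •
          phi K (insert i ((insert (i + 1) F).erase j))) =
        -∑ j ∈ F, ((-1 : K) ^ sgn j (insert i (insert (i + 1) F)) * t ^ (j - 1)) •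
          phi K (insert i ((insert (i + 1) F).erase j)) := by
      rw [← sum_neg_distrib]
      refine sum_congr rfl fun j hj => ?_
      rw [map_smul, Tgen_phi_of_mem t (by simp) (by grind), smul_neg]
    rw [hsum, pow_succ]
    module

theorem sgn_erase_of_lt {i j : ℕ} {E : Finset ℕ} (hi : i ∈ E) (h : i < j) :
    sgn j E = sgn j (E.erase i) + 1 := by
  conv_lhs => rw [← insert_erase hi]
  exact sgn_insert_of_lt (by simp) h

theorem sgn_erase_of_le {i j : ℕ} {E : Finset ℕ} (hi : i ∈ E) (h : j ≤ i) :
    sgn j E = sgn j (E.erase i) := by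
  conv_lhs => rw [← insert_erase hi]
  exact sgn_insert_of_le h

theorem neg_one_pow_sgn_erase_antisymm {i j : ℕ} {E : Finset ℕ} (hi : i ∈ E) (hj : j ∈ E)
    (hij : i ≠ j) :
    (-1 : K) ^ sgn i E * (-1) ^ sgn j (E.erase i) =
      -((-1) ^ sgn j E * (-1) ^ sgn i (E.erase j)) := by
  rcases lt_or_gt_of_ne hij with h | h
  · rw [sgn_erase_of_lt hi h, sgn_erase_of_le hj h.le]
    ring
  · rw [sgn_erase_of_lt hj h, sgn_erase_of_le hi h.le]
    ring

theorem Dop_Dop (p : Finset ℕ →₀ K) : Dop t (Dop t p) = 0 := by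
  suffices h : Dop t ∘ₗ Dop t = 0 from LinearMap.congr_fun h p
  refine hom_ext_phi fun E => ?_
  simp only [LinearMap.comp_apply, LinearMap.zero_apply, Dop_phi, map_sum, map_smul, smul_sum]
  rw [sum_sigma']
  refine sum_involution (fun x _ => ⟨x.2, x.1⟩) ?_ ?_ ?_ ?_
  · rintro ⟨i, j⟩ hx
    simp only [mem_sigma, mem_erase] at hx
    obtain ⟨hi, hji, hj⟩ := hx
    simp only [smul_smul]
    rw [erase_right_comm, ← add_smul]
    convert zero_smul K _ using 2
    linear_combination (t ^ (i - 1) * t ^ (j - 1)) *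
      neg_one_pow_sgn_erase_antisymm (K := K) hi hj hji.symm
  · rintro ⟨i, j⟩ hx _ h
    simp only [mem_sigma, mem_erase] at hx
    simp only [Sigma.mk.injEq] at h
    exact hx.2.1 h.1
  · rintro ⟨i, j⟩ hx
    simp only [mem_sigma, mem_erase] at hx ⊢
    exact ⟨hx.2.2, hx.2.1.symm, hx.1⟩
  · rintro ⟨i, j⟩ _
    rfl

theorem Tgen_phi_erase_self {i : ℕ} {S : Finset ℕ} (h0 : i ∈ S) (h1 : i + 1 ∈ S) :
    Tgen t i (phi K (S.erase i)) =
      t • phi K (S.erase (i + 1)) + (t - 1) • phi K (S.erase i) := by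
  rw [Tgen_phi, if_neg (by simp), if_pos (by simp [h1]), erase_right_comm,
    insert_erase (by simp [h0])]

theorem Tgen_phi_erase_of_lt {i j : ℕ} {S : Finset ℕ} (h0 : i ∈ S) (h1 : i + 1 ∈ S)
    (hj : j < i) : Tgen t i (phi K (S.erase j)) = -phi K (S.erase j) :=
  Tgen_phi_of_mem t (by simp [h0]; omega) (by simp [h1]; omega)

theorem qint_succ (n : ℕ) : qint t (n + 1) = qint t n + t ^ n :=
  sum_range_succ _ _

theorem qint_one : qint t 1 = 1 := by simp [qint]

theorem sub_one_mul_qint (n : ℕ) : (t - 1) * qint t n = t ^ n - 1 :=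
  mul_geom_sum t n

theorem kappa_natCast {n : ℕ} (hn : 1 ≤ n) : kappa t n = t ^ n / qint t n := by
  rw [kappa, if_pos (by omega), Int.toNat_natCast]

/-- The partial products of the factors `T_i - κ_n` applied to `φ_{S∖{a}}`: after `k` factors,
with `n` the index of the last `κ` used. -/
noncomputable def partialAntisym (S : Finset ℕ) (a n k : ℕ) : Finset ℕ →₀ K :=
  t ^ k • phi K (S.erase (a + k)) +
    (qint t n)⁻¹ • ∑ j ∈ range k, ((-1 : K) ^ (k - j) * t ^ j) • phi K (S.erase (a + j))

theorem Tgen_sub_kappa_partialAntisym {S : Finset ℕ} {a n k : ℕ} (h0 : a + k ∈ S)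
    (h1 : a + k + 1 ∈ S) (hn : 1 ≤ n) (hq : qint t n ≠ 0)
    (hq' : k = 0 ∨ qint t (n + 1) ≠ 0) :
    (Tgen t (a + k) - kappa t n • 1 : Module.End K (Finset ℕ →₀ K))
      (partialAntisym t S a (n + 1) k) = partialAntisym t S a n (k + 1) := by
  have hsum : Tgen t (a + k) (∑ j ∈ range k, ((-1 : K) ^ (k - j) * t ^ j) •
        phi K (S.erase (a + j))) =
      -∑ j ∈ range k, ((-1 : K) ^ (k - j) * t ^ j) • phi K (S.erase (a + j)) := by
    rw [map_sum, ← sum_neg_distrib]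
    refine sum_congr rfl fun j hj => ?_
    rw [map_smul, Tgen_phi_erase_of_lt t h0 h1 (by grind), smul_neg]
  have hsum' : ∑ j ∈ range k, ((-1 : K) ^ (k + 1 - j) * t ^ j) • phi K (S.erase (a + j)) =
      -∑ j ∈ range k, ((-1 : K) ^ (k - j) * t ^ j) • phi K (S.erase (a + j)) := by
    rw [← sum_neg_distrib]
    refine sum_congr rfl fun j hj => ?_
    rw [Nat.succ_sub (by grind), pow_succ]
    module
  have hcoef : (qint t (n + 1))⁻¹ • (1 + kappa t n) •
      ∑ j ∈ range k, ((-1 : K) ^ (k - j) * t ^ j) • phi K (S.erase (a + j)) =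
      (qint t n)⁻¹ •
        ∑ j ∈ range k, ((-1 : K) ^ (k - j) * t ^ j) • phi K (S.erase (a + j)) := by
    rcases hq' with rfl | hq'
    · simp
    · rw [smul_smul, kappa_natCast t hn]
      congr 1
      rw [qint_succ] at hq' ⊢
      field_simp
  have hdiag : (qint t n)⁻¹ = kappa t n - (t - 1) := by
    rw [kappa_natCast t hn]
    field_simp
    linear_combination sub_one_mul_qint t n
  simp only [partialAntisym, LinearMap.sub_apply, LinearMap.smul_apply, Module.End.one_apply,
    map_add, map_smul, hsum, Tgen_phi_erase_self t h0 h1, sum_range_succ, hsum', smul_add,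
    smul_neg, ← hcoef, ← add_assoc]
  have hk : k + 1 - k = 1 := by omega
  rw [hk, hdiag]
  module

theorem sgn_Icc {a N i : ℕ} (h : a + i ≤ N + 1) : sgn (a + i) (Icc a N) = i := by
  have : (Icc a N).filter (· < a + i) = Ico a (a + i) := by
    ext x
    simp only [mem_filter, mem_Icc, mem_Ico]
    omega
  rw [sgn, this, Nat.card_Ico]
  omega

theorem Dop_phi_Icc (a k : ℕ) (ha : 1 ≤ a) :
    Dop t (phi K (Icc a (a + k))) = ∑ i ∈ range (k + 1),
      ((-1 : K) ^ i * t ^ (a - 1 + i)) • phi K ((Icc a (a + k)).erase (a + i)) := by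
  have hI : (Icc a (a + k)) = Ico a (a + k + 1) := by ext; simp
  rw [Dop_phi]
  conv_lhs => rw [sum_congr hI fun _ _ => rfl]
  rw [sum_Ico_eq_sum_range]
  refine sum_congr (by congr 1; omega) fun i hi => ?_
  rw [sgn_Icc (by grind), Nat.sub_add_comm ha]

end Operators

/-- With `π_i = φ_{{N−m−1,…,N}∖{i}}`, the product
`(T_{N−1} − t)(T_{N−2} − κ_2)⋯(T_{N−m−1} − κ_{m+1})` (rightmost factor acting
first) sends `π_{N−m−1}` to `Σ_{i=0}^{m+1} (−1)^{m+1−i} t^i π_{N−m−1+i}`, which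
equals `(−1)^{m+1} t^{m+2−N} D(φ_{{N−m−1,…,N}})`; in particular the product
annihilates `D(π_{N−m−1})`. -/
theorem type0_tilde_product_formula {K : Type*} [Field K] (t : K) (N m : ℕ)
    (hN : 2 ≤ N) (hm : m ≤ N - 2) (ht0 : t ≠ 0)
    (hreg : ∀ n : ℕ, 1 ≤ n → n ≤ m + 1 → qint t n ≠ 0) :
    (((Tgen t (N - 1) - t • 1) *
        ((List.range m).map fun l =>
          (Tgen t (N - 2 - l) : Module.End K (Finset ℕ →₀ K))
            - kappa t ((l : ℤ) + 2) • 1).prod)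
        (phi K ((Finset.Icc (N - m - 1) N).erase (N - m - 1)))
      = ∑ i ∈ Finset.range (m + 2),
          ((-1 : K) ^ (m + 1 - i) * t ^ i) •
            phi K ((Finset.Icc (N - m - 1) N).erase (N - m - 1 + i))) ∧
    (∑ i ∈ Finset.range (m + 2),
        ((-1 : K) ^ (m + 1 - i) * t ^ i) •
          phi K ((Finset.Icc (N - m - 1) N).erase (N - m - 1 + i))
      = ((-1 : K) ^ (m + 1) * t ^ ((m : ℤ) + 2 - N)) •
          Dop t (phi K (Finset.Icc (N - m - 1) N))) ∧
    (((Tgen t (N - 1) - t • 1) *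
        ((List.range m).map fun l =>
          (Tgen t (N - 2 - l) : Module.End K (Finset ℕ →₀ K))
            - kappa t ((l : ℤ) + 2) • 1).prod)
        (Dop t (phi K ((Finset.Icc (N - m - 1) N).erase (N - m - 1)))) = 0) := by
  obtain ⟨a, ha, rfl⟩ : ∃ a, 1 ≤ a ∧ N = a + (m + 1) := ⟨N - m - 1, by omega, by omega⟩
  have ha' : a + (m + 1) - m - 1 = a := by omega
  simp only [ha']
  set S := Icc a (a + (m + 1)) with hS
  set f : ℕ → Module.End K (Finset ℕ →₀ K) := fun l =>
    Tgen t (a + (m + 1) - 2 - l) - kappa t ((l : ℤ) + 2) • 1 with hf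
  have hprod : ∀ q ≤ m, ((List.range q).map f).prod (partialAntisym t S a (q + 2) (m - q)) =
      partialAntisym t S a 2 m := by
    intro q hq
    induction q with
    | zero => simp
    | succ q ih =>
      rw [List.range_succ, List.map_append, List.prod_append, List.map_singleton,
        List.prod_singleton, Module.End.mul_apply, ← ih (by omega)]
      congr 1
      have h1 : a + (m + 1) - 2 - q = a + (m - (q + 1)) := by omega
      have h2 : (q : ℤ) + 2 = ((q + 2 : ℕ) : ℤ) := by push_cast; rfl
      have h3 : m - q = m - (q + 1) + 1 := by omega
      rw [hf, h3]
      simp only [h1, h2]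
      refine Tgen_sub_kappa_partialAntisym t (by simp [hS]; omega) (by simp [hS]; omega)
        (by omega) (hreg _ (by omega) (by omega)) ?_
      rcases Nat.eq_zero_or_pos (m - (q + 1)) with h | h
      · exact Or.inl h
      · exact Or.inr (hreg _ (by omega) (by omega))
  have hstart : partialAntisym t S a (m + 2) (m - m) = phi K (S.erase a) := by
    simp [partialAntisym]
  have hone : qint t 1 ≠ 0 := by simp [qint_one]
  have hlast := Tgen_sub_kappa_partialAntisym t (S := S) (a := a) (n := 1) (k := m)
    (by simp [hS]) (by simp [hS]; omega) le_rfl hone (by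
      rcases Nat.eq_zero_or_pos m with h | h
      · exact Or.inl h
      · exact Or.inr (hreg _ (by omega) (by omega)))
  have hkappa : kappa t ((1 : ℕ) : ℤ) = t := by
    rw [kappa_natCast t le_rfl, qint_one, pow_one, div_one]
  have hidx : a + (m + 1) - 1 = a + m := by omega
  have hformula : ((Tgen t (a + (m + 1) - 1) - t • 1) * ((List.range m).map f).prod)
      (phi K (S.erase a)) = ∑ i ∈ range (m + 2),
        ((-1 : K) ^ (m + 1 - i) * t ^ i) • phi K (S.erase (a + i)) := by
    rw [Module.End.mul_apply, ← hstart, hprod m le_rfl, hidx]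
    rw [hkappa] at hlast
    rw [hlast, partialAntisym, qint_one, inv_one, one_smul, sum_range_succ _ (m + 1),
      Nat.sub_self, pow_zero, one_mul, add_comm]
  have hD : ∑ i ∈ range (m + 2),
        ((-1 : K) ^ (m + 1 - i) * t ^ i) • phi K (S.erase (a + i)) =
      ((-1 : K) ^ (m + 1) * t ^ ((m : ℤ) + 2 - ((a + (m + 1) : ℕ) : ℤ))) •
        Dop t (phi K S) := by
    rw [hS, Dop_phi_Icc t a (m + 1) ha, smul_sum]
    refine sum_congr rfl fun i hi => ?_
    rw [smul_smul]
    congr 1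
    have hsign : (-1 : K) ^ (m + 1) * (-1) ^ i = (-1) ^ (m + 1 - i) := by
      have h : m + 1 = (m + 1 - i) + i := by grind
      conv_lhs => rw [h, pow_add, mul_assoc, ← mul_pow]
      simp
    have hpow : t ^ ((m : ℤ) + 2 - ((a + (m + 1) : ℕ) : ℤ)) * t ^ (a - 1 + i) = t ^ i := by
      rw [← zpow_natCast, ← zpow_natCast, ← zpow_add₀ ht0]
      congr 1
      omega
    rw [← hsign]
    linear_combination (-(-1 : K) ^ (m + 1) * (-1) ^ i) * hpow
  refine ⟨hformula, hD, ?_⟩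
  have hfactor : ∀ (T : Module.End K (Finset ℕ →₀ K)) (c : K),
      Commute T (Dop t) → Commute (Dop t) (T - c • 1) := fun T c hT => by
    refine LinearMap.ext fun p => ?_
    have h : T (Dop t p) = Dop t (T p) := LinearMap.congr_fun hT.eq p
    simp [Module.End.mul_apply, h]
  have hcomm : Commute (Dop t : Module.End K (Finset ℕ →₀ K))
      ((Tgen t (a + (m + 1) - 1) - t • 1) * ((List.range m).map f).prod) := by
    refine (hfactor _ _ (Tgen_commute_Dop t (by omega))).mul_right (Commute.list_prod_right _ _ fun x hx => ?_)
    obtain ⟨l, hl, rfl⟩ := List.mem_map.mp hx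
    rw [List.mem_range] at hl
    exact hfactor _ _ (Tgen_commute_Dop t (by omega))
  rw [← Module.End.mul_apply, ← hcomm.eq, Module.End.mul_apply, hformula, hD, map_smul,
    Dop_Dop, smul_zero]
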